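/- arXiv:2112.12084 — 2 statements merged into one kernel-verified Lean document; each statement's English description precedes it below -/
import Mathlib

section
/- Let α ∈ (0, 1/2), σ > 0, k̄ > 0 and p ∈ (1/2, 1). Then the map k ↦ AD(k; k̄, p) is nonincreasing on (0, k̄], AD(k̄; k̄, p) = 0, and consequently AD(k; k̄, p) ≥ 0 for every k ∈ (0, k̄]; that is, reducing the sample size can only decrease the estimated certified radius. -/
open Set Filter

/-- The (unnormalized) Beta function `Beta(a,b) = ∫₀¹ t^(a−1)(1−t)^(b−1) dt`. -/
noncomputable def betaFn (a b : ℝ) : ℝ :=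
  ∫ t in (0:ℝ)..1, t ^ (a - 1) * (1 - t) ^ (b - 1)

/-- The regularized incomplete Beta function `I_x(a,b)`. -/
noncomputable def regBeta (x a b : ℝ) : ℝ :=
  (∫ t in (0:ℝ)..x, t ^ (a - 1) * (1 - t) ^ (b - 1)) / betaFn a b

/-- The Beta quantile `Q(α; a, b)`: the unique `x ∈ (0,1)` with `I_x(a,b) = α`
(realized as the infimum of the solution set, which is a singleton when the
quantile is well-defined). -/
noncomputable def betaQuantile (α a b : ℝ) : ℝ :=
  sInf {x : ℝ | x ∈ Set.Ioo (0:ℝ) 1 ∧ regBeta x a b = α}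

/-- The standard Gaussian CDF `Φ`. -/
noncomputable def stdGaussCDF (t : ℝ) : ℝ :=
  ∫ s in Set.Iic t, (Real.sqrt (2 * Real.pi))⁻¹ * Real.exp (-(s ^ 2) / 2)

/-- The inverse `Φ⁻¹` of the standard Gaussian CDF. -/
noncomputable def stdGaussCDFInv : ℝ → ℝ := Function.invFun stdGaussCDF

/-- The absolute decline `AD(k; k̄, p)`. -/
noncomputable def absDecline (α σ kbar k p : ℝ) : ℝ :=
  σ * stdGaussCDFInv (betaQuantile α (p * kbar) (kbar - p * kbar + 1)) -
    σ * stdGaussCDFInv (betaQuantile α (p * k) (k - p * k + 1))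

/-- The input-specific sample size `ψ_AD(p)` for the absolute-decline criterion. -/
noncomputable def psiAD (α σ kbar U p : ℝ) : ℝ :=
  sInf {k : ℝ | k ∈ Set.Ioc (0:ℝ) kbar ∧ absDecline α σ kbar k p ≤ U}

/-- The relative decline `RD(k; k̄, p)`. -/
noncomputable def relDecline (α σ kbar k p : ℝ) : ℝ :=
  absDecline α σ kbar k p /
    (σ * stdGaussCDFInv (betaQuantile α (p * kbar) (kbar - p * kbar + 1)))

/-- The input-specific sample size `ψ_RD(p)` for the relative-decline criterion. -/
noncomputable def psiRD (α σ kbar U p : ℝ) : ℝ :=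
  sInf {k : ℝ | k ∈ Set.Ioc (0:ℝ) kbar ∧ relDecline α σ kbar k p ≤ U}

open Classical in
/-- The piecewise-constant approximation `ψ_ISS` of `ψ_AD` on a grid of width `δ`. -/
noncomputable def psiISS (α σ kbar U δ p : ℝ) : ℝ :=
  if ∃ N : ℕ, p = (N : ℝ) * δ then psiAD α σ kbar U p
  else max (psiAD α σ kbar U ((⌊p / δ⌋ : ℝ) * δ)) (psiAD α σ kbar U ((⌈p / δ⌉ : ℝ) * δ))

open MeasureTheory Topology

lemma integrable_stdGauss :
    Integrable fun s : ℝ => (Real.sqrt (2 * Real.pi))⁻¹ * Real.exp (-(s ^ 2) / 2) := by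
  have h := (integrable_exp_neg_mul_sq (show (0 : ℝ) < 1 / 2 by norm_num)).const_mul
    (Real.sqrt (2 * Real.pi))⁻¹
  refine h.congr (Eventually.of_forall fun s => ?_)
  simp only
  congr 2
  ring

lemma integral_stdGauss :
    ∫ s : ℝ, (Real.sqrt (2 * Real.pi))⁻¹ * Real.exp (-(s ^ 2) / 2) = 1 := by
  rw [integral_const_mul]
  have h := integral_gaussian (1 / 2)
  rw [show Real.pi / (1 / 2) = 2 * Real.pi by ring] at h
  have e : (fun s : ℝ => Real.exp (-(s ^ 2) / 2)) = fun s => Real.exp (-(1 / 2) * s ^ 2) := by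
    funext s
    congr 1
    ring
  rw [e, h]
  exact inv_mul_cancel₀ (Real.sqrt_pos.2 (by positivity)).ne'

lemma stdGaussCDF_sub (a b : ℝ) : stdGaussCDF b - stdGaussCDF a =
    ∫ s in a..b, (Real.sqrt (2 * Real.pi))⁻¹ * Real.exp (-(s ^ 2) / 2) :=
  intervalIntegral.integral_Iic_sub_Iic integrable_stdGauss.integrableOn
    integrable_stdGauss.integrableOn

lemma strictMono_stdGaussCDF : StrictMono stdGaussCDF := by
  intro a b hab
  rw [← sub_pos, stdGaussCDF_sub]
  refine intervalIntegral.intervalIntegral_pos_of_pos_on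
    integrable_stdGauss.intervalIntegrable (fun s _ => by positivity) hab

lemma continuous_stdGaussCDF : Continuous stdGaussCDF := by
  have h : stdGaussCDF = fun t => stdGaussCDF 0 +
      ∫ s in (0 : ℝ)..t, (Real.sqrt (2 * Real.pi))⁻¹ * Real.exp (-(s ^ 2) / 2) := by
    funext t
    rw [← stdGaussCDF_sub]
    ring
  rw [h]
  exact continuous_const.add (intervalIntegral.continuous_primitive
    (fun _ _ => integrable_stdGauss.intervalIntegrable) 0)

lemma tendsto_stdGaussCDF_atTop : Tendsto stdGaussCDF atTop (𝓝 1) := by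
  rw [← integral_stdGauss]
  exact (aecover_Iic tendsto_id).integral_tendsto_of_countably_generated integrable_stdGauss

lemma tendsto_stdGaussCDF_atBot : Tendsto stdGaussCDF atBot (𝓝 0) := by
  have h := (aecover_Ioi (μ := volume) (tendsto_id (α := ℝ))
    (l := atBot)).integral_tendsto_of_countably_generated integrable_stdGauss
  have h2 := h.const_sub 1
  rw [integral_stdGauss, sub_self] at h2
  refine h2.congr fun t => ?_
  have := intervalIntegral.integral_Iic_add_Ioi (b := t)
    integrable_stdGauss.integrableOn integrable_stdGauss.integrableOn
  rw [integral_stdGauss] at this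
  rw [id, stdGaussCDF]
  linarith

lemma stdGaussCDF_stdGaussCDFInv {u : ℝ} (hu : u ∈ Ioo (0 : ℝ) 1) :
    stdGaussCDF (stdGaussCDFInv u) = u := by
  obtain ⟨t, -, ht⟩ := isPreconnected_univ.intermediate_value_Ioo (l₁ := atBot) (l₂ := atTop)
    (by simp) (by simp) continuous_stdGaussCDF.continuousOn tendsto_stdGaussCDF_atBot
    tendsto_stdGaussCDF_atTop hu
  exact Function.invFun_eq ⟨t, ht⟩

lemma monotoneOn_stdGaussCDFInv : MonotoneOn stdGaussCDFInv (Ioo 0 1) := by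
  intro u hu v hv huv
  rwa [← strictMono_stdGaussCDF.le_iff_le, stdGaussCDF_stdGaussCDFInv hu,
    stdGaussCDF_stdGaussCDFInv hv]

/-- The integrand of the incomplete Beta function. -/
noncomputable def betaKernel (a b t : ℝ) : ℝ := t ^ (a - 1) * (1 - t) ^ (b - 1)

lemma intervalIntegrable_betaKernel {a b : ℝ} (ha : 0 < a) (hb : 1 ≤ b) (x y : ℝ) :
    IntervalIntegrable (betaKernel a b) volume x y := by
  refine (intervalIntegral.intervalIntegrable_rpow' (by linarith)).mul_continuousOn
    (Continuous.continuousOn ?_)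
  exact (continuous_const.sub continuous_id).rpow_const fun _ => Or.inr (sub_nonneg.2 hb)

lemma betaKernel_pos {a b t : ℝ} (ht : t ∈ Ioo (0 : ℝ) 1) : 0 < betaKernel a b t :=
  mul_pos (Real.rpow_pos_of_pos ht.1 _) (Real.rpow_pos_of_pos (sub_pos.2 ht.2) _)

lemma integral_betaKernel_pos {a b x y : ℝ} (ha : 0 < a) (hb : 1 ≤ b) (hx : 0 ≤ x)
    (hxy : x < y) (hy : y ≤ 1) : 0 < ∫ t in x..y, betaKernel a b t :=
  intervalIntegral.intervalIntegral_pos_of_pos_on (intervalIntegrable_betaKernel ha hb x y)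
    (fun _ ht => betaKernel_pos ⟨hx.trans_lt ht.1, ht.2.trans_le hy⟩) hxy

lemma regBeta_eq (x a b : ℝ) : regBeta x a b =
    (∫ t in (0 : ℝ)..x, betaKernel a b t) / ∫ t in (0 : ℝ)..1, betaKernel a b t := rfl

lemma strictMonoOn_regBeta {a b : ℝ} (ha : 0 < a) (hb : 1 ≤ b) :
    StrictMonoOn (fun x => regBeta x a b) (Icc 0 1) := by
  intro x hx y hy hxy
  have h := integral_betaKernel_pos ha hb hx.1 hxy hy.2
  have hI := intervalIntegrable_betaKernel ha hb
  rw [← intervalIntegral.integral_interval_sub_left (hI 0 y) (hI 0 x), sub_pos] at h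
  simp only [regBeta_eq]
  exact div_lt_div_of_pos_right h (integral_betaKernel_pos ha hb le_rfl one_pos le_rfl)

lemma betaQuantile_spec {α a b : ℝ} (hα : α ∈ Ioo (0 : ℝ) 1) (ha : 0 < a) (hb : 1 ≤ b) :
    betaQuantile α a b ∈ Ioo (0 : ℝ) 1 ∧ regBeta (betaQuantile α a b) a b = α := by
  have hcont : Continuous fun x => regBeta x a b := by
    simp only [regBeta_eq]
    exact (intervalIntegral.continuous_primitive
      (intervalIntegrable_betaKernel ha hb) 0).div_const _
  have h0 : regBeta 0 a b = 0 := by simp [regBeta_eq]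
  have h1 : regBeta 1 a b = 1 := by
    rw [regBeta_eq]
    exact div_self (integral_betaKernel_pos ha hb le_rfl one_pos le_rfl).ne'
  obtain ⟨x, hx, hxα⟩ := intermediate_value_Ioo zero_le_one hcont.continuousOn
    (show α ∈ Ioo (regBeta 0 a b) (regBeta 1 a b) by rwa [h0, h1])
  have hset : {x : ℝ | x ∈ Ioo (0 : ℝ) 1 ∧ regBeta x a b = α} = {x} := by
    ext y
    refine ⟨fun hy => ?_, fun hy => ?_⟩
    · exact (strictMonoOn_regBeta ha hb).injOn (Ioo_subset_Icc_self hy.1)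
        (Ioo_subset_Icc_self hx) (hy.2.trans hxα.symm)
    · rw [mem_singleton_iff.1 hy]
      exact ⟨hx, hxα⟩
  rw [betaQuantile, hset, csInf_singleton]
  exact ⟨hx, hxα⟩

/-- The lower solution of `t ^ p * (1 - t) ^ (1 - p) = m`, parametrized by a hyperbolic angle. -/
noncomputable def lowerBranch (p z : ℝ) : ℝ :=
  Real.exp (-((1 - p) * z)) * (Real.sinh (p * z) / Real.sinh z)

lemma mul_cosh_mul_sinh_le {p z : ℝ} (hp : p ∈ Ioo (0 : ℝ) 1) (hz : 0 ≤ z) :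
    p * Real.cosh (p * z) * Real.sinh z ≤ Real.sinh (p * z) * Real.cosh z := by
  let D : ℝ → ℝ := fun z => Real.sinh (p * z) * Real.cosh z - p * Real.cosh (p * z) * Real.sinh z
  have hD : ∀ z, HasDerivAt D ((1 - p ^ 2) * (Real.sinh (p * z) * Real.sinh z)) z := by
    intro z
    have hpz : HasDerivAt (fun z : ℝ => p * z) p z := by
      simpa using (hasDerivAt_id z).const_mul p
    have h := (hpz.sinh.mul (Real.hasDerivAt_cosh z)).sub
      ((hpz.cosh.const_mul p).mul (Real.hasDerivAt_sinh z))
    exact h.congr_deriv (by ring)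
  have hmono : MonotoneOn D (Ici 0) := by
    refine monotoneOn_of_deriv_nonneg (convex_Ici 0)
      (fun z _ => (hD z).continuousAt.continuousWithinAt)
      (fun z _ => (hD z).differentiableAt.differentiableWithinAt) fun z hz => ?_
    rw [interior_Ici, mem_Ioi] at hz
    rw [(hD z).deriv]
    have h1 : 0 ≤ 1 - p ^ 2 := by nlinarith [hp.1, hp.2]
    exact mul_nonneg h1 (mul_nonneg (Real.sinh_nonneg_iff.2 (mul_nonneg hp.1.le hz.le))
      (Real.sinh_nonneg_iff.2 hz.le))
  have h := hmono self_mem_Ici hz hz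
  simp only [D, mul_zero, Real.sinh_zero, zero_mul, sub_zero] at h
  linarith

lemma hasDerivAt_sinh_mul_div_sinh {p z : ℝ} (hz : 0 < z) :
    HasDerivAt (fun z => Real.sinh (p * z) / Real.sinh z)
      ((p * Real.cosh (p * z) * Real.sinh z - Real.sinh (p * z) * Real.cosh z) /
        Real.sinh z ^ 2) z := by
  have hpz : HasDerivAt (fun z : ℝ => p * z) p z := by
    simpa using (hasDerivAt_id z).const_mul p
  exact (hpz.sinh.div (Real.hasDerivAt_sinh z) (Real.sinh_pos_iff.2 hz).ne').congr_deriv (by ring)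

lemma exists_hasDerivAt_sinh_mul_div_sinh {p z : ℝ} (hp : p ∈ Ioo (0 : ℝ) 1) (hz : 0 < z) :
    ∃ d ≤ 0, HasDerivAt (fun z => Real.sinh (p * z) / Real.sinh z) d z :=
  ⟨_, div_nonpos_of_nonpos_of_nonneg (by linarith [mul_cosh_mul_sinh_le hp hz.le])
    (sq_nonneg _), hasDerivAt_sinh_mul_div_sinh hz⟩

lemma sinh_mul_div_sinh_pos {p z : ℝ} (hp : 0 < p) (hz : 0 < z) :
    0 < Real.sinh (p * z) / Real.sinh z :=
  div_pos (Real.sinh_pos_iff.2 (mul_pos hp hz)) (Real.sinh_pos_iff.2 hz)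

lemma lowerBranch_pos {p z : ℝ} (hp : 0 < p) (hz : 0 < z) : 0 < lowerBranch p z :=
  mul_pos (Real.exp_pos _) (sinh_mul_div_sinh_pos hp hz)

lemma one_sub_lowerBranch {p z : ℝ} (hz : 0 < z) :
    1 - lowerBranch p z = Real.exp (p * z) * (Real.sinh ((1 - p) * z) / Real.sinh z) := by
  have h : Real.sinh z ≠ 0 := (Real.sinh_pos_iff.2 hz).ne'
  rw [lowerBranch]
  field_simp
  have e1 : Real.exp (-((1 - p) * z)) * Real.sinh (p * z) =
      (Real.exp (-((1 - p) * z) + p * z) - Real.exp (-z)) / 2 := by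
    rw [Real.sinh_eq, Real.exp_add, show -z = -((1 - p) * z) + -(p * z) by ring, Real.exp_add]
    ring
  have e2 : Real.exp (p * z) * Real.sinh ((1 - p) * z) =
      (Real.exp z - Real.exp (-((1 - p) * z) + p * z)) / 2 := by
    have : Real.exp z = Real.exp (p * z) * Real.exp ((1 - p) * z) := by
      rw [← Real.exp_add]; congr 1; ring
    rw [Real.sinh_eq, Real.exp_add, this]
    ring
  rw [e1, e2, Real.sinh_eq]
  ring

lemma hasDerivAt_exp_mul_sinh_mul_div_sinh {p c z d : ℝ}
    (h : HasDerivAt (fun z => Real.sinh (p * z) / Real.sinh z) d z) :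
    HasDerivAt (fun z => Real.exp (c * z) * (Real.sinh (p * z) / Real.sinh z))
      (Real.exp (c * z) * (d + c * (Real.sinh (p * z) / Real.sinh z))) z := by
  have hcz : HasDerivAt (fun z : ℝ => c * z) c z := by
    simpa using (hasDerivAt_id z).const_mul c
  exact (hcz.exp.mul h).congr_deriv (by ring)

lemma lowerBranch_eq (p : ℝ) : lowerBranch p =
    fun z => Real.exp (-(1 - p) * z) * (Real.sinh (p * z) / Real.sinh z) := by
  funext z
  rw [lowerBranch, neg_mul]

lemma one_sub_lowerBranch_one_sub {p z : ℝ} (hz : 0 < z) :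
    1 - lowerBranch (1 - p) z =
      Real.exp ((1 - p) * z) * (Real.sinh (p * z) / Real.sinh z) := by
  rw [one_sub_lowerBranch hz, sub_sub_cancel]

lemma hasDerivAt_lowerBranch {p z d : ℝ}
    (h : HasDerivAt (fun z => Real.sinh (p * z) / Real.sinh z) d z) :
    HasDerivAt (lowerBranch p) (Real.exp (-(1 - p) * z) *
      (d + -(1 - p) * (Real.sinh (p * z) / Real.sinh z))) z := by
  rw [lowerBranch_eq]
  exact hasDerivAt_exp_mul_sinh_mul_div_sinh h

lemma strictAntiOn_lowerBranch {p : ℝ} (hp : p ∈ Ioo (0 : ℝ) 1) :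
    StrictAntiOn (lowerBranch p) (Ioi 0) := by
  refine strictAntiOn_of_deriv_neg (convex_Ioi 0) (fun z hz => ?_) fun z hz => ?_
  · exact (hasDerivAt_lowerBranch
      (hasDerivAt_sinh_mul_div_sinh hz)).continuousAt.continuousWithinAt
  · rw [interior_Ioi] at hz
    obtain ⟨d, hd, h⟩ := exists_hasDerivAt_sinh_mul_div_sinh hp hz
    rw [(hasDerivAt_lowerBranch h).deriv]
    have := mul_pos (sub_pos.2 hp.2) (sinh_mul_div_sinh_pos hp.1 hz)
    exact mul_neg_of_pos_of_neg (Real.exp_pos _) (by linarith)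

lemma tendsto_lowerBranch_zero (p : ℝ) :
    Tendsto (lowerBranch p) (𝓝[>] 0) (𝓝 p) := by
  have hs : ∀ c : ℝ, Tendsto (fun z : ℝ => z⁻¹ * Real.sinh (c * z)) (𝓝[>] 0) (𝓝 c) := by
    intro c
    have hcz : HasDerivAt (fun z : ℝ => c * z) c 0 := by
      simpa using (hasDerivAt_id (0 : ℝ)).const_mul c
    simpa using hcz.sinh.tendsto_slope_zero_right
  have he : Tendsto (fun z : ℝ => Real.exp (-((1 - p) * z))) (𝓝[>] 0) (𝓝 1) := by
    have : Continuous fun z : ℝ => Real.exp (-((1 - p) * z)) := by fun_prop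
    simpa using (this.tendsto 0).mono_left nhdsWithin_le_nhds
  have h := he.mul ((hs p).div (hs 1) one_ne_zero)
  rw [one_mul, div_one] at h
  refine h.congr' ?_
  filter_upwards [self_mem_nhdsWithin] with z hz
  have hz' : z ≠ 0 := (mem_Ioi.1 hz).ne'
  simp only [lowerBranch, Pi.div_apply, one_mul]
  rw [mul_div_mul_left _ _ (inv_ne_zero hz')]

lemma tendsto_lowerBranch_atTop {p : ℝ} (hp : p ∈ Ioo (0 : ℝ) 1) :
    Tendsto (lowerBranch p) atTop (𝓝 0) := by
  have he : Tendsto (fun z : ℝ => Real.exp (-((1 - p) * z))) atTop (𝓝 0) :=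
    Real.tendsto_exp_neg_atTop_nhds_zero.comp
      (tendsto_id.const_mul_atTop (sub_pos.2 hp.2))
  refine squeeze_zero' ?_ ?_ he
  · filter_upwards [eventually_gt_atTop 0] with z hz using (lowerBranch_pos hp.1 hz).le
  · filter_upwards [eventually_gt_atTop 0] with z hz
    refine mul_le_of_le_one_right (Real.exp_pos _).le ?_
    rw [div_le_one (Real.sinh_pos_iff.2 hz), Real.sinh_le_sinh]
    nlinarith [hp.2]

lemma lowerBranch_le {p z : ℝ} (hp : p ∈ Ioo (0 : ℝ) 1) (hz : 0 < z) :
    lowerBranch p z ≤ p := by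
  refine ge_of_tendsto (tendsto_lowerBranch_zero p) ?_
  filter_upwards [Ioo_mem_nhdsGT hz] with y hy
  exact ((strictAntiOn_lowerBranch hp).lt_iff_gt hz hy.1 |>.2 hy.2).le

lemma Ioo_subset_image_lowerBranch {p : ℝ} (hp : p ∈ Ioo (0 : ℝ) 1) :
    Ioo 0 p ⊆ lowerBranch p '' Ioi 0 := by
  refine isPreconnected_Ioi.intermediate_value_Ioo (l₁ := atTop) (l₂ := 𝓝[>] 0)
    ?_ inf_le_right (fun z hz => ?_) (tendsto_lowerBranch_atTop hp) (tendsto_lowerBranch_zero p)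
  · exact le_principal_iff.2 (Ioi_mem_atTop 0)
  · exact (hasDerivAt_lowerBranch
      (hasDerivAt_sinh_mul_div_sinh hz)).continuousAt.continuousWithinAt

/-- The weighted geometric mean `t ^ p * (1 - t) ^ (1 - p)`, a unimodal function of `t`. -/
noncomputable def geomWeight (p t : ℝ) : ℝ := t ^ p * (1 - t) ^ (1 - p)

lemma geomWeight_lowerBranch {p z : ℝ} (hp : p ∈ Ioo (0 : ℝ) 1) (hz : 0 < z) :
    geomWeight p (lowerBranch p z) =
      (Real.sinh (p * z) / Real.sinh z) ^ p *
        (Real.sinh ((1 - p) * z) / Real.sinh z) ^ (1 - p) := by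
  have h1 := sinh_mul_div_sinh_pos hp.1 hz
  have h2 := sinh_mul_div_sinh_pos (sub_pos.2 hp.2) hz
  rw [geomWeight, one_sub_lowerBranch hz, lowerBranch,
    Real.mul_rpow (Real.exp_pos _).le h1.le, Real.mul_rpow (Real.exp_pos _).le h2.le,
    ← Real.exp_mul, ← Real.exp_mul, mul_mul_mul_comm, ← Real.exp_add,
    show -((1 - p) * z) * p + p * z * (1 - p) = 0 by ring, Real.exp_zero, one_mul]

lemma geomWeight_one_sub (p t : ℝ) : geomWeight p (1 - t) = geomWeight (1 - p) t := by
  rw [geomWeight, geomWeight, sub_sub_cancel, sub_sub_cancel, mul_comm]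

lemma geomWeight_upper {p z : ℝ} (hp : p ∈ Ioo (0 : ℝ) 1) (hz : 0 < z) :
    geomWeight p (1 - lowerBranch (1 - p) z) = geomWeight p (lowerBranch p z) := by
  rw [geomWeight_one_sub, geomWeight_lowerBranch hp hz,
    geomWeight_lowerBranch ⟨sub_pos.2 hp.2, sub_lt_self _ hp.1⟩ hz, sub_sub_cancel, mul_comm]

/-- A nonnegative function of `geomWeight p` has, for the measure `dt / t`, at most as much
mass above the mode `p` as below it. -/
lemma lintegral_geomWeight_upper_le {p : ℝ} (hp : p ∈ Ioo (0 : ℝ) 1) (g : ℝ → ENNReal) :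
    ∫⁻ t in Ioo p 1, ENNReal.ofReal t⁻¹ * g (geomWeight p t) ≤
      ∫⁻ t in Ioc 0 p, ENNReal.ofReal t⁻¹ * g (geomWeight p t) := by
  have hq : 1 - p ∈ Ioo (0 : ℝ) 1 := ⟨sub_pos.2 hp.2, sub_lt_self _ hp.1⟩
  let S : ℝ → ℝ := fun z => Real.sinh (p * z) / Real.sinh z
  let S' : ℝ → ℝ := fun z =>
    (p * Real.cosh (p * z) * Real.sinh z - Real.sinh (p * z) * Real.cosh z) / Real.sinh z ^ 2
  have hS : ∀ z ∈ Ioi (0 : ℝ), HasDerivAt S (S' z) z := fun z hz =>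
    hasDerivAt_sinh_mul_div_sinh hz
  let r : ℝ → ℝ := fun z => 1 - lowerBranch (1 - p) z
  have hr : ∀ z ∈ Ioi (0 : ℝ), r z = Real.exp ((1 - p) * z) * S z := fun z hz =>
    one_sub_lowerBranch_one_sub hz
  have hr' : ∀ z ∈ Ioi (0 : ℝ), HasDerivWithinAt r
      (Real.exp ((1 - p) * z) * (S' z + (1 - p) * S z)) (Ioi 0) z := fun z hz =>
    ((hasDerivAt_exp_mul_sinh_mul_div_sinh (hS z hz)).hasDerivWithinAt).congr hr (hr z hz)
  have hl' : ∀ z ∈ Ioi (0 : ℝ), HasDerivWithinAt (lowerBranch p)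
      (Real.exp (-(1 - p) * z) * (S' z + -(1 - p) * S z)) (Ioi 0) z := fun z hz =>
    (hasDerivAt_lowerBranch (hS z hz)).hasDerivWithinAt
  have hrinj : InjOn r (Ioi 0) := fun a ha b hb hab =>
    (strictAntiOn_lowerBranch hq).injOn ha hb (sub_right_injective hab)
  have hsub : Ioo p 1 ⊆ r '' Ioi 0 := by
    intro t ht
    obtain ⟨z, hz, hzt⟩ := Ioo_subset_image_lowerBranch hq
      (show 1 - t ∈ Ioo 0 (1 - p) from ⟨by linarith [ht.2], by linarith [ht.1]⟩)
    exact ⟨z, hz, by simp only [r]; linarith⟩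
  have hlsub : lowerBranch p '' Ioi 0 ⊆ Ioc 0 p := by
    rintro _ ⟨z, hz, rfl⟩
    exact ⟨lowerBranch_pos hp.1 hz, lowerBranch_le hp hz⟩
  refine (lintegral_mono_set hsub).trans (le_trans ?_ (lintegral_mono_set hlsub))
  rw [lintegral_image_eq_lintegral_abs_deriv_mul measurableSet_Ioi hr' hrinj,
    lintegral_image_eq_lintegral_abs_deriv_mul measurableSet_Ioi hl'
      (strictAntiOn_lowerBranch hp).injOn]
  refine setLIntegral_mono' measurableSet_Ioi fun z hz => ?_
  have hSpos : 0 < S z := sinh_mul_div_sinh_pos hp.1 hz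
  have hS'np : S' z ≤ 0 := div_nonpos_of_nonpos_of_nonneg
    (by linarith [mul_cosh_mul_sinh_le hp (mem_Ioi.1 hz).le]) (sq_nonneg _)
  rw [show geomWeight p (r z) = geomWeight p (lowerBranch p z) from geomWeight_upper hp hz,
    ← mul_assoc, ← mul_assoc, ← ENNReal.ofReal_mul (abs_nonneg _),
    ← ENNReal.ofReal_mul (abs_nonneg _)]
  refine mul_le_mul' (ENNReal.ofReal_le_ofReal ?_) le_rfl
  have key : ∀ c, |Real.exp (c * z) * (S' z + c * S z)| * (Real.exp (c * z) * S z)⁻¹ =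
      |S' z + c * S z| / S z := by
    intro c
    have := Real.exp_pos (c * z)
    rw [abs_mul, abs_of_pos this]
    field_simp
  rw [hr z hz, lowerBranch_eq, key, key]
  have := mul_pos hq.1 hSpos
  refine div_le_div_of_nonneg_right ?_ hSpos.le
  rw [abs_of_neg (show S' z + -(1 - p) * S z < 0 by linarith), abs_le]
  constructor <;> linarith

lemma geomWeight_pos {p t : ℝ} (ht : t ∈ Ioo (0 : ℝ) 1) : 0 < geomWeight p t :=
  mul_pos (Real.rpow_pos_of_pos ht.1 _) (Real.rpow_pos_of_pos (sub_pos.2 ht.2) _)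

lemma monotoneOn_geomWeight {p : ℝ} (hp : p ∈ Ioo (0 : ℝ) 1) :
    MonotoneOn (geomWeight p) (Ioc 0 p) := by
  intro s hs t ht hst
  have ht1 : 0 < 1 - t := by linarith [ht.2, hp.2]
  have hs1 : 0 < 1 - s := by linarith [hs.2, hp.2]
  have h := Real.geom_mean_le_arith_mean2_weighted hp.1.le (sub_pos.2 hp.2).le
    (div_pos hs.1 ht.1).le (div_pos hs1 ht1).le (add_sub_cancel p 1)
  have hle : p * (s / t) + (1 - p) * ((1 - s) / (1 - t)) ≤ 1 := by
    have ht0 := ht.1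
    rw [← sub_nonneg]
    have e : 1 - (p * (s / t) + (1 - p) * ((1 - s) / (1 - t))) =
        (t - s) * (p - t) / (t * (1 - t)) := by
      field_simp
      ring
    rw [e]
    exact div_nonneg (mul_nonneg (sub_nonneg.2 hst) (sub_nonneg.2 ht.2))
      (mul_pos ht0 ht1).le
  rw [Real.div_rpow hs.1.le ht.1.le, Real.div_rpow hs1.le ht1.le, div_mul_div_comm] at h
  exact (div_le_one (geomWeight_pos ⟨ht.1, sub_pos.1 ht1⟩)).1 (h.trans hle)

lemma continuous_geomWeight {p : ℝ} (hp : p ∈ Ioo (0 : ℝ) 1) :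
    Continuous (geomWeight p) :=
  (continuous_id.rpow_const fun _ => Or.inr hp.1.le).mul
    ((continuous_const.sub continuous_id).rpow_const fun _ => Or.inr (sub_pos.2 hp.2).le)

lemma betaKernel_eq_geomWeight {p k t : ℝ} (ht : t ∈ Ioo (0 : ℝ) 1) :
    betaKernel (p * k) (k - p * k + 1) t = t⁻¹ * geomWeight p t ^ k := by
  have h1 : 0 < 1 - t := sub_pos.2 ht.2
  rw [betaKernel, geomWeight, Real.mul_rpow (Real.rpow_nonneg ht.1.le _)
    (Real.rpow_nonneg h1.le _), ← Real.rpow_mul ht.1.le, ← Real.rpow_mul h1.le,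
    Real.rpow_sub_one ht.1.ne']
  ring_nf

/-- Weighting a Beta kernel of mode parameter `p` by a nonnegative function of `geomWeight p`
puts at most as much mass above `p` as below it. -/
lemma integral_mul_betaKernel_upper_le {p k : ℝ} (hp : p ∈ Ioo (0 : ℝ) 1) (hk : 0 < k)
    {f : ℝ → ℝ} (hf : Continuous f) (hf0 : ∀ m, 0 ≤ f m) :
    ∫ t in p..1, f (geomWeight p t) * betaKernel (p * k) (k - p * k + 1) t ≤
      ∫ t in (0 : ℝ)..p, f (geomWeight p t) * betaKernel (p * k) (k - p * k + 1) t := by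
  have hI : ∀ x y, IntervalIntegrable
      (fun t => f (geomWeight p t) * betaKernel (p * k) (k - p * k + 1) t) volume x y := by
    intro x y
    exact (intervalIntegrable_betaKernel (mul_pos hp.1 hk) (by nlinarith [hp.2])
      x y).continuousOn_mul (hf.comp (continuous_geomWeight hp)).continuousOn
  have hI' := fun x y => (hI x y).1
  have hnn : ∀ t ∈ Ioo (0 : ℝ) 1,
      0 ≤ f (geomWeight p t) * betaKernel (p * k) (k - p * k + 1) t := fun t ht =>
    mul_nonneg (hf0 _) (betaKernel_pos ht).le
  have hlo : ∀ t ∈ Ioc 0 p, t ∈ Ioo (0 : ℝ) 1 := fun t ht => ⟨ht.1, ht.2.trans_lt hp.2⟩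
  have hup : ∀ t ∈ Ioo p 1, t ∈ Ioo (0 : ℝ) 1 := fun t ht => ⟨hp.1.trans ht.1, ht.2⟩
  have hconv : ∀ t ∈ Ioo (0 : ℝ) 1,
      ENNReal.ofReal (f (geomWeight p t) * betaKernel (p * k) (k - p * k + 1) t) =
      ENNReal.ofReal t⁻¹ * ENNReal.ofReal (f (geomWeight p t) * geomWeight p t ^ k) := by
    intro t ht
    rw [betaKernel_eq_geomWeight ht, ← ENNReal.ofReal_mul (inv_pos.2 ht.1).le]
    congr 1
    ring
  rw [intervalIntegral.integral_of_le hp.2.le, intervalIntegral.integral_of_le hp.1.le,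
    integral_Ioc_eq_integral_Ioo, ← ENNReal.ofReal_le_ofReal_iff
      (setIntegral_nonneg measurableSet_Ioc fun t ht => hnn t (hlo t ht)),
    ofReal_integral_eq_lintegral_ofReal ((hI' p 1).mono_set Ioo_subset_Ioc_self)
      (ae_restrict_of_forall_mem measurableSet_Ioo fun t ht => hnn t (hup t ht)),
    ofReal_integral_eq_lintegral_ofReal (hI' 0 p)
      (ae_restrict_of_forall_mem measurableSet_Ioc fun t ht => hnn t (hlo t ht)),
    setLIntegral_congr_fun measurableSet_Ioo fun t ht => hconv t (hup t ht),
    setLIntegral_congr_fun measurableSet_Ioc fun t ht => hconv t (hlo t ht)]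
  exact lintegral_geomWeight_upper_le hp fun m => ENNReal.ofReal (f m * m ^ k)

lemma half_le_regBeta {p k : ℝ} (hp : p ∈ Ioo (0 : ℝ) 1) (hk : 0 < k) :
    1 / 2 ≤ regBeta p (p * k) (k - p * k + 1) := by
  have ha : 0 < p * k := mul_pos hp.1 hk
  have hb : 1 ≤ k - p * k + 1 := by nlinarith [hp.2]
  have hI := intervalIntegrable_betaKernel ha hb
  have h := integral_mul_betaKernel_upper_le hp hk (continuous_const (y := (1 : ℝ)))
    fun _ => zero_le_one
  simp only [one_mul] at h
  have hadd := intervalIntegral.integral_add_adjacent_intervals (hI 0 p) (hI p 1)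
  rw [regBeta_eq, le_div_iff₀ (integral_betaKernel_pos ha hb le_rfl one_pos le_rfl)]
  linarith

/-- Below the median, the regularized incomplete Beta function decreases in the sample size. -/
lemma regBeta_le_of_le {p k k' x : ℝ} (hp : p ∈ Ioo (0 : ℝ) 1) (hk : 0 < k) (hkk : k ≤ k')
    (hx : x ∈ Ioo (0 : ℝ) 1) (hlt : regBeta x (p * k) (k - p * k + 1) < 1 / 2) :
    regBeta x (p * k') (k' - p * k' + 1) ≤ regBeta x (p * k) (k - p * k + 1) := by
  have ha : 0 < p * k := mul_pos hp.1 hk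
  have hb : 1 ≤ k - p * k + 1 := by nlinarith [hp.2]
  have hd : 0 ≤ k' - k := sub_nonneg.2 hkk
  have hxp : x < p := (strictMonoOn_regBeta ha hb).lt_iff_lt (Ioo_subset_Icc_self hx)
    (Ioo_subset_Icc_self hp) |>.1 (hlt.trans_le (half_le_regBeta hp hk))
  set w := betaKernel (p * k) (k - p * k + 1) with hw
  let c : ℝ := geomWeight p x ^ (k' - k)
  let φ : ℝ → ℝ := fun t => geomWeight p t ^ (k' - k)
  have hI : ∀ u v, IntervalIntegrable w volume u v := intervalIntegrable_betaKernel ha hb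
  have hφ : Continuous φ := (continuous_geomWeight hp).rpow_const fun _ => Or.inr hd
  have hIφ : ∀ u v, IntervalIntegrable (fun t => φ t * w t) volume u v := fun u v =>
    (hI u v).continuousOn_mul hφ.continuousOn
  have hwpos : ∀ t ∈ Ioo (0 : ℝ) 1, 0 < w t := fun t ht => betaKernel_pos ht
  have hφmono : ∀ s t, 0 < s → s ≤ t → t ≤ p → φ s ≤ φ t := fun s t hs hst htp =>
    Real.rpow_le_rpow (geomWeight_pos ⟨hs, (hst.trans htp).trans_lt hp.2⟩).le
      (monotoneOn_geomWeight hp ⟨hs, hst.trans htp⟩ ⟨hs.trans_le hst, htp⟩ hst) hd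
  have hker : ∀ u v, 0 ≤ u → u ≤ v → v ≤ 1 →
      ∫ t in u..v, betaKernel (p * k') (k' - p * k' + 1) t = ∫ t in u..v, φ t * w t := by
    intro u v hu huv hv
    refine intervalIntegral.integral_congr_Ioo_of_le huv fun t ht => ?_
    have ht' : t ∈ Ioo (0 : ℝ) 1 := ⟨hu.trans_lt ht.1, ht.2.trans_le hv⟩
    simp only [φ, hw]
    rw [betaKernel_eq_geomWeight ht', betaKernel_eq_geomWeight ht', mul_left_comm,
      ← Real.rpow_add (geomWeight_pos ht'), sub_add_cancel]
  have hpos : 0 < ∫ t in (0 : ℝ)..1, φ t * w t :=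
    intervalIntegral.intervalIntegral_pos_of_pos_on (hIφ 0 1)
      (fun t ht => mul_pos (Real.rpow_pos_of_pos (geomWeight_pos ht) _) (hwpos t ht)) one_pos
  have hw1 : 0 < ∫ t in (0 : ℝ)..1, w t := integral_betaKernel_pos ha hb le_rfl one_pos le_rfl
  have hA : 0 < ∫ t in (0 : ℝ)..x, w t := integral_betaKernel_pos ha hb le_rfl hx.1 hx.2.le
  have hadd := intervalIntegral.integral_add_adjacent_intervals (hI 0 x) (hI x 1)
  have haddφ := intervalIntegral.integral_add_adjacent_intervals (hIφ 0 x) (hIφ x 1)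
  have hsub : ∀ u v, ∫ t in u..v, (c - φ t) * w t =
      c * (∫ t in u..v, w t) - ∫ t in u..v, φ t * w t := by
    intro u v
    rw [← intervalIntegral.integral_const_mul,
      ← intervalIntegral.integral_sub ((hI u v).const_mul c) (hIφ u v)]
    simp only [sub_mul]
  have hIsub : ∀ u v, IntervalIntegrable (fun t => (c - φ t) * w t) volume u v := fun u v =>
    (hI u v).continuousOn_mul (continuous_const.sub hφ).continuousOn
  have hImax : ∀ u v, IntervalIntegrable (fun t => max (c - φ t) 0 * w t) volume u v :=
    fun u v => (hI u v).continuousOn_mul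
      ((continuous_const.sub hφ).max continuous_const).continuousOn
  have hlow : 0 ≤ ∫ t in (0 : ℝ)..x, (c - φ t) * w t := by
    rw [intervalIntegral.integral_of_le hx.1.le, integral_Ioc_eq_integral_Ioo]
    exact setIntegral_nonneg measurableSet_Ioo fun t ht =>
      mul_nonneg (sub_nonneg.2 (hφmono t x ht.1 ht.2.le hxp.le))
        (hwpos t ⟨ht.1, ht.2.trans hx.2⟩).le
  have hmid : ∫ t in x..p, (c - φ t) * w t ≤ ∫ t in x..p, (0 : ℝ) :=
    intervalIntegral.integral_mono_on_of_le_Ioo hxp.le (hIsub x p) intervalIntegrable_const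
      fun t ht => mul_nonpos_of_nonpos_of_nonneg
        (sub_nonpos.2 (hφmono x t hx.1 ht.1.le ht.2.le))
        (hwpos t ⟨hx.1.trans ht.1, ht.2.trans hp.2⟩).le
  have hhigh : ∫ t in p..1, (c - φ t) * w t ≤ ∫ t in p..1, max (c - φ t) 0 * w t :=
    intervalIntegral.integral_mono_on_of_le_Ioo hp.2.le (hIsub p 1) (hImax p 1)
      fun t ht => mul_le_mul_of_nonneg_right (le_max_left _ _)
        (hwpos t ⟨hp.1.trans ht.1, ht.2⟩).le
  have hrefl : ∫ t in p..1, max (c - φ t) 0 * w t ≤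
      ∫ t in (0 : ℝ)..p, max (c - φ t) 0 * w t :=
    integral_mul_betaKernel_upper_le hp hk (f := fun m => max (c - m ^ (k' - k)) 0)
      ((continuous_const.sub (Real.continuous_rpow_const hd)).max continuous_const)
      fun _ => le_max_right _ _
  have hmax_low : ∫ t in (0 : ℝ)..x, max (c - φ t) 0 * w t =
      ∫ t in (0 : ℝ)..x, (c - φ t) * w t :=
    intervalIntegral.integral_congr_Ioo_of_le hx.1.le fun t ht => by
      rw [max_eq_left (sub_nonneg.2 (hφmono t x ht.1 ht.2.le hxp.le))]
  have hmax_mid : ∫ t in x..p, max (c - φ t) 0 * w t = ∫ t in x..p, (0 : ℝ) :=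
    intervalIntegral.integral_congr_Ioo_of_le hxp.le fun t ht => by
      rw [max_eq_right (sub_nonpos.2 (hφmono x t hx.1 ht.1.le ht.2.le)), zero_mul]
  have hmax_add := intervalIntegral.integral_add_adjacent_intervals (hImax 0 x) (hImax x p)
  have hsub_add := intervalIntegral.integral_add_adjacent_intervals (hIsub x p) (hIsub p 1)
  rw [intervalIntegral.integral_zero] at hmid hmax_mid
  have hcmp : ∫ t in x..1, (c - φ t) * w t ≤ ∫ t in (0 : ℝ)..x, (c - φ t) * w t := by
    linarith
  rw [regBeta_eq, div_lt_iff₀ hw1] at hlt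
  rw [regBeta_eq, regBeta_eq, hker 0 x le_rfl hx.1.le hx.2.le,
    hker 0 1 le_rfl zero_le_one le_rfl, div_le_div_iff₀ hpos hw1, ← hadd, ← haddφ]
  rw [← hadd] at hlt
  rw [hsub] at hlow
  rw [hsub, hsub] at hcmp
  generalize (∫ t in (0 : ℝ)..x, w t) = A at *
  generalize (∫ t in x..1, w t) = B at *
  generalize (∫ t in (0 : ℝ)..x, φ t * w t) = A' at *
  generalize (∫ t in x..1, φ t * w t) = B' at *
  have hAB : A ≤ B := by linarith
  have h1 := mul_le_mul_of_nonneg_left hcmp hA.le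
  have h2 := mul_le_mul_of_nonneg_right hAB hlow
  linarith

lemma monotoneOn_betaQuantile {α p : ℝ} (hα : α ∈ Ioo (0 : ℝ) (1 / 2))
    (hp : p ∈ Ioo (0 : ℝ) 1) :
    MonotoneOn (fun k => betaQuantile α (p * k) (k - p * k + 1)) (Ioi 0) := by
  intro k hk k' hk' hkk
  have hα' : α ∈ Ioo (0 : ℝ) 1 := ⟨hα.1, by linarith [hα.2]⟩
  have ha : ∀ k ∈ Ioi (0 : ℝ), 0 < p * k := fun k hk => mul_pos hp.1 hk
  have hb : ∀ k ∈ Ioi (0 : ℝ), 1 ≤ k - p * k + 1 := fun k hk => by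
    nlinarith [hp.2, mem_Ioi.1 hk]
  obtain ⟨hx, hxα⟩ := betaQuantile_spec hα' (ha k hk) (hb k hk)
  obtain ⟨hy, hyα⟩ := betaQuantile_spec hα' (ha k' hk') (hb k' hk')
  refine ((strictMonoOn_regBeta (ha k' hk') (hb k' hk')).le_iff_le (Ioo_subset_Icc_self hx)
    (Ioo_subset_Icc_self hy)).1 ?_
  exact (regBeta_le_of_le hp hk hkk hx (by rw [hxα]; exact hα.2)).trans
    (hxα.trans hyα.symm).le

/-- Reducing the sample size can only decrease the estimated certified radius:
the absolute decline is nonincreasing in the sample size on the interval from 0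
to the desired sample size, vanishes at the desired sample size, and is nonnegative. -/
theorem absDecline_antitone_zero_nonneg
    (α σ kbar p : ℝ)
    (hα : α ∈ Set.Ioo (0:ℝ) (1/2)) (hσ : 0 < σ) (hkbar : 0 < kbar)
    (hp : p ∈ Set.Ioo (1/2 : ℝ) 1) :
    AntitoneOn (fun k => absDecline α σ kbar k p) (Set.Ioc (0:ℝ) kbar) ∧
    absDecline α σ kbar kbar p = 0 ∧
    ∀ k ∈ Set.Ioc (0:ℝ) kbar, 0 ≤ absDecline α σ kbar k p := by
  have hp' : p ∈ Ioo (0 : ℝ) 1 := ⟨by linarith [hp.1], hp.2⟩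
  have hα' : α ∈ Ioo (0 : ℝ) 1 := ⟨hα.1, by linarith [hα.2]⟩
  have hmem : ∀ k ∈ Ioc (0 : ℝ) kbar,
      betaQuantile α (p * k) (k - p * k + 1) ∈ Ioo (0 : ℝ) 1 := fun k hk =>
    (betaQuantile_spec hα' (mul_pos hp'.1 hk.1) (by nlinarith [hp.2, hk.1])).1
  have hanti : AntitoneOn (fun k => absDecline α σ kbar k p) (Ioc (0 : ℝ) kbar) :=
    fun k hk k' hk' hkk => sub_le_sub_left (mul_le_mul_of_nonneg_left
      (monotoneOn_stdGaussCDFInv (hmem k hk) (hmem k' hk')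
        (monotoneOn_betaQuantile hα hp' hk.1 hk'.1 hkk)) hσ.le) _
  have hzero : absDecline α σ kbar kbar p = 0 := sub_self _
  exact ⟨hanti, hzero, fun k hk => hzero ▸ hanti hk ⟨hkbar, le_rfl⟩ hk.2⟩
end

section
/- Let n ∈ ℕ with n ≥ 1, p ∈ (0,1) and α ∈ (0,1). Define the one-sided Clopper–Pearson lower bound L(m) := Q(α; m, n − m + 1) for 1 ≤ m ≤ n and L(0) := 0. Then the coverage guarantee holds: ∑_{m ∈ {0,…,n} : L(m) ≤ p} C(n,m)·p^m·(1−p)^(n−m) ≥ 1 − α; that is, if K is Binomial(n,p) distributed, then L(K) ≤ p with probability at least 1 − α. -/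
open Set Filter

/-- The upper tail `∑_{k = j + 1}^{n} C(n,k) X^k (1 - X)^(n - k)` of the binomial distribution, as a
polynomial in the success probability. -/
noncomputable def binomialTail (n j : ℕ) : Polynomial ℝ :=
  ∑ k ∈ Finset.Ico j n, bernsteinPolynomial ℝ n (k + 1)

lemma eval_bernsteinPolynomial (n k : ℕ) (x : ℝ) :
    (bernsteinPolynomial ℝ n k).eval x = (n.choose k : ℝ) * x ^ k * (1 - x) ^ (n - k) := by
  simp [bernsteinPolynomial]

lemma derivative_binomialTail {n j : ℕ} (hj : j < n) :
    Polynomial.derivative (binomialTail n j) = n * bernsteinPolynomial ℝ (n - 1) j := by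
  have hlast : bernsteinPolynomial ℝ (n - 1) n = 0 :=
    bernsteinPolynomial.eq_zero_of_lt ℝ (by omega)
  have htelescope := Finset.sum_Ico_sub (fun k => bernsteinPolynomial ℝ (n - 1) k) hj.le
  simp only [binomialTail, Polynomial.derivative_sum, bernsteinPolynomial.derivative_succ,
    ← Finset.mul_sum]
  rw [← neg_inj, ← mul_neg, ← Finset.sum_neg_distrib]
  simp only [neg_sub]
  rw [htelescope, hlast]
  ring

lemma eval_zero_binomialTail (n j : ℕ) : (binomialTail n j).eval 0 = 0 := by
  simp [binomialTail, Polynomial.eval_finsetSum, eval_bernsteinPolynomial]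

lemma eval_one_binomialTail {n j : ℕ} (hj : j < n) : (binomialTail n j).eval 1 = 1 := by
  rw [binomialTail, Polynomial.eval_finsetSum, Finset.sum_eq_single (n - 1)]
  · rw [Nat.sub_add_cancel (by omega)]
    simp [eval_bernsteinPolynomial]
  · intro k hk hne
    have hk' := Finset.mem_Ico.1 hk
    rw [eval_bernsteinPolynomial, sub_self, zero_pow (by omega), mul_zero]
  · intro h
    exact absurd (Finset.mem_Ico.2 ⟨by omega, by omega⟩) h

lemma integral_betaKernel {n j : ℕ} (hj : j < n) (x : ℝ) :
    (n * (n - 1).choose j : ℝ) * ∫ t in (0:ℝ)..x,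
      t ^ (((j + 1 : ℕ) : ℝ) - 1) * (1 - t) ^ ((n : ℝ) - ((j + 1 : ℕ) : ℝ) + 1 - 1) =
      (binomialTail n j).eval x := by
  have h := intervalIntegral.integral_eq_sub_of_hasDerivAt (a := 0) (b := x)
    (fun t _ => (binomialTail n j).hasDerivAt t)
    ((Polynomial.derivative (binomialTail n j)).continuous.intervalIntegrable 0 x)
  rw [eval_zero_binomialTail, sub_zero] at h
  rw [← h, ← intervalIntegral.integral_const_mul]
  congr 1
  funext t
  have hleft : ((j + 1 : ℕ) : ℝ) - 1 = (j : ℕ) := by push_cast; ring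
  have hright : (n : ℝ) - ((j + 1 : ℕ) : ℝ) + 1 - 1 = ((n - 1 - j : ℕ) : ℝ) := by
    rw [Nat.sub_sub, Nat.cast_sub (by omega)]
    push_cast
    ring
  rw [hleft, hright, Real.rpow_natCast, Real.rpow_natCast, derivative_binomialTail hj,
    Polynomial.eval_mul, Polynomial.eval_natCast, eval_bernsteinPolynomial]
  ring

/-- With integer parameters the regularized incomplete Beta function is a binomial tail. -/
lemma regBeta_eq_eval_binomialTail {n j : ℕ} (hj : j < n) (x : ℝ) :
    regBeta x ((j + 1 : ℕ) : ℝ) ((n : ℝ) - ((j + 1 : ℕ) : ℝ) + 1) =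
      (binomialTail n j).eval x := by
  have hx := integral_betaKernel hj x
  have hone := integral_betaKernel hj 1
  rw [eval_one_binomialTail hj] at hone
  rw [regBeta, betaFn, div_eq_iff (right_ne_zero_of_mul_eq_one hone)]
  apply mul_left_cancel₀ (left_ne_zero_of_mul_eq_one hone)
  rw [hx, mul_left_comm, hone, mul_one]

lemma eval_binomialTail_le_of_lt_betaQuantile {n j : ℕ} (hj : j < n) {p α : ℝ}
    (hp : p ∈ Set.Ioo (0:ℝ) 1) (hα : 0 < α)
    (h : p < betaQuantile α ((j + 1 : ℕ) : ℝ) ((n : ℝ) - ((j + 1 : ℕ) : ℝ) + 1)) :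
    (binomialTail n j).eval p ≤ α := by
  by_contra! hlt
  obtain ⟨x, hx, hxα⟩ := intermediate_value_Ioo hp.1.le
    (binomialTail n j).continuous.continuousOn
    ⟨(eval_zero_binomialTail n j).trans_lt hα, hlt⟩
  refine (h.trans_le (csInf_le ⟨0, fun y hy => hy.1.1.le⟩
    ⟨⟨hx.1, hx.2.trans hp.2⟩, ?_⟩)).not_gt hx.2
  exact (regBeta_eq_eval_binomialTail hj x).trans hxα

/-- Coverage guarantee of the one-sided Clopper–Pearson lower confidence bound. -/
theorem clopperPearson_one_sided_coverage
    (n : ℕ) (hn : 1 ≤ n) (p α : ℝ) (hp : p ∈ Set.Ioo (0:ℝ) 1)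
    (hα : α ∈ Set.Ioo (0:ℝ) 1)
    (L : ℕ → ℝ)
    (hL0 : L 0 = 0)
    (hL : ∀ m : ℕ, 1 ≤ m → m ≤ n →
      L m = betaQuantile α (m : ℝ) ((n : ℝ) - (m : ℝ) + 1)) :
    1 - α ≤
      ∑ m ∈ (Finset.range (n + 1)).filter (fun m => L m ≤ p),
        (n.choose m : ℝ) * p ^ m * (1 - p) ^ (n - m) := by
  have hterm (m : ℕ) : 0 ≤ (n.choose m : ℝ) * p ^ m * (1 - p) ^ (n - m) :=
    mul_nonneg (mul_nonneg (Nat.cast_nonneg _) (pow_nonneg hp.1.le _))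
      (pow_nonneg (sub_nonneg.2 hp.2.le) _)
  have htotal : ∑ m ∈ Finset.range (n + 1),
      (n.choose m : ℝ) * p ^ m * (1 - p) ^ (n - m) = 1 := by
    simpa [Polynomial.eval_finsetSum, eval_bernsteinPolynomial] using
      congrArg (Polynomial.eval p) (bernsteinPolynomial.sum ℝ n)
  rw [← Finset.sum_filter_add_sum_filter_not _ (fun m => L m ≤ p)] at htotal
  suffices ∑ m ∈ (Finset.range (n + 1)).filter (fun m => ¬ L m ≤ p),
      (n.choose m : ℝ) * p ^ m * (1 - p) ^ (n - m) ≤ α by linarith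
  rcases ((Finset.range (n + 1)).filter (fun m => ¬ L m ≤ p)).eq_empty_or_nonempty with
    hempty | hne
  · rw [hempty, Finset.sum_empty]
    exact hα.1.le
  obtain ⟨m, hm, hmin⟩ := Finset.exists_min_image _ id hne
  obtain ⟨hmn, hmL⟩ := Finset.mem_filter.1 hm
  obtain _ | j := m
  · exact absurd (hL0.trans_le hp.1.le) hmL
  have hj : j < n := by simpa using hmn
  rw [hL (j + 1) (by omega) hj, not_le] at hmL
  refine le_trans ?_ (eval_binomialTail_le_of_lt_betaQuantile hj hp hα.1 hmL)
  rw [binomialTail, Finset.sum_Ico_add' (fun k => bernsteinPolynomial ℝ n k),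
    Polynomial.eval_finsetSum]
  simp only [eval_bernsteinPolynomial]
  refine Finset.sum_le_sum_of_subset_of_nonneg (fun k hk => ?_) (fun k _ _ => hterm k)
  exact Finset.mem_Ico.2 ⟨hmin k hk, Finset.mem_range.1 (Finset.mem_filter.1 hk).1⟩
end
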